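/- Let x̂ be a basic maximum-weight fractional matching and y a minimum fractional w-vertex cover in a weighted graph G. Pick a vertex s on an odd cycle C ∈ 𝒞(x̂), and let x̄ be obtained from x̂ by alternate rounding on C at s. Then the restriction of x̄ to the edges of G∖s is a basic maximum-weight fractional matching of G∖s, and the restriction of y to V∖{s} is a minimum fractional w-vertex cover of G∖s. -/

import Mathlib

namespace Stabilizer

variable {V : Type*} [Fintype V] [DecidableEq V]

/-- The set of vertices covered by a finite set of edges. -/
def edgeVerts (C : Finset (Sym2 V)) : Set V := {v | ∃ e ∈ C, v ∈ e}

/-- A matching of `G`, given as a finite set of pairwise vertex-disjoint edges. -/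
def IsMatching (G : SimpleGraph V) (M : Finset (Sym2 V)) : Prop :=
  (↑M ⊆ G.edgeSet) ∧ ∀ e ∈ M, ∀ f ∈ M, e ≠ f → ∀ v : V, v ∈ e → v ∉ f

/-- The total weight of a finite set of edges. -/
noncomputable def setWeight (w : Sym2 V → ℝ) (M : Finset (Sym2 V)) : ℝ := ∑ e ∈ M, w e

/-- ν(G): the maximum weight of a matching of `G`. -/
noncomputable def nu (G : SimpleGraph V) (w : Sym2 V → ℝ) : ℝ :=
  sSup {r : ℝ | ∃ M : Finset (Sym2 V), IsMatching G M ∧ r = setWeight w M}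

/-- A fractional matching of `G`. -/
def IsFracMatching (G : SimpleGraph V) (x : Sym2 V → ℝ) : Prop :=
  (∀ e, 0 ≤ x e) ∧ (∀ e, e ∉ G.edgeSet → x e = 0) ∧ ∀ v : V, ∑ u : V, x s(v, u) ≤ 1

/-- The weight of a fractional matching. -/
noncomputable def fracWeight (w x : Sym2 V → ℝ) : ℝ := ∑ e : Sym2 V, w e * x e

/-- ν_f(G): the maximum weight of a fractional matching of `G`. -/
noncomputable def nuf (G : SimpleGraph V) (w : Sym2 V → ℝ) : ℝ :=
  sSup {r : ℝ | ∃ x : Sym2 V → ℝ, IsFracMatching G x ∧ r = fracWeight w x}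

/-- A maximum-weight fractional matching of `G`. -/
def IsMaxFracMatching (G : SimpleGraph V) (w x : Sym2 V → ℝ) : Prop :=
  IsFracMatching G x ∧ ∀ y : Sym2 V → ℝ, IsFracMatching G y → fracWeight w y ≤ fracWeight w x

/-- All entries lie in {0, 1/2, 1}. -/
def IsHalfIntegral (x : Sym2 V → ℝ) : Prop := ∀ e, x e = 0 ∨ x e = 1 / 2 ∨ x e = 1

/-- `C` is the edge set of an odd cycle of `G`. -/
def IsOddCycleEdgeSet (G : SimpleGraph V) (C : Finset (Sym2 V)) : Prop :=
  ∃ (v : V) (c : G.Walk v v), c.IsCycle ∧ Odd c.length ∧ c.edges.toFinset = C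

/-- `F` is the family 𝒞(x) of vertex-disjoint odd cycles carrying exactly the
half-valued edges of `x`. -/
def IsCycleFamily (G : SimpleGraph V) (x : Sym2 V → ℝ) (F : Finset (Finset (Sym2 V))) : Prop :=
  (∀ C ∈ F, IsOddCycleEdgeSet G C) ∧
  (∀ C ∈ F, ∀ D ∈ F, C ≠ D → Disjoint (edgeVerts C) (edgeVerts D)) ∧
  (∀ e : Sym2 V, x e = 1 / 2 ↔ ∃ C ∈ F, e ∈ C)

/-- A basic fractional matching of `G`. -/
def IsBasic (G : SimpleGraph V) (x : Sym2 V → ℝ) : Prop :=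
  IsFracMatching G x ∧ IsHalfIntegral x ∧ ∃ F, IsCycleFamily G x F

/-- γ(G): the minimum number of odd cycles in the support of a basic
maximum-weight fractional matching of `G`. -/
noncomputable def gamma (G : SimpleGraph V) (w : Sym2 V → ℝ) : ℕ :=
  sInf {n : ℕ | ∃ (x : Sym2 V → ℝ) (F : Finset (Finset (Sym2 V))),
    IsMaxFracMatching G w x ∧ IsHalfIntegral x ∧ IsCycleFamily G x F ∧ F.card = n}

/-- `G` is stable: ν(G) = ν_f(G). -/
def IsStable (G : SimpleGraph V) (w : Sym2 V → ℝ) : Prop := nu G w = nuf G w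

/-- Deletion of a set of vertices (as the spanning subgraph obtained by
removing all edges incident to `S`; matchings, fractional matchings and covers
of `G∖S` correspond to those of this graph). -/
def deleteVerts (G : SimpleGraph V) (S : Set V) : SimpleGraph V where
  Adj a b := G.Adj a b ∧ a ∉ S ∧ b ∉ S
  symm := ⟨fun _ _ h => ⟨h.1.symm, h.2.2, h.2.1⟩⟩
  loopless := ⟨fun a h => G.loopless.irrefl a h.1⟩

/-- A fractional w-vertex cover of `G`. -/
def IsFracCover (G : SimpleGraph V) (w : Sym2 V → ℝ) (y : V → ℝ) : Prop :=
  (∀ v, 0 ≤ y v) ∧ ∀ a b : V, G.Adj a b → w s(a, b) ≤ y a + y b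

noncomputable def coverValue (y : V → ℝ) : ℝ := ∑ v : V, y v

/-- A minimum fractional w-vertex cover of `G`. -/
def IsMinFracCover (G : SimpleGraph V) (w : Sym2 V → ℝ) (y : V → ℝ) : Prop :=
  IsFracCover G w y ∧ ∀ z : V → ℝ, IsFracCover G w z → coverValue y ≤ coverValue z

/-- M(x): the 1-valued edges of `x`. -/
noncomputable def oneEdges (x : Sym2 V → ℝ) : Finset (Sym2 V) :=
  Finset.univ.filter fun e => x e = 1

/-- `v` is exposed by the matching `M`. -/
def MExposed (M : Finset (Sym2 V)) (v : V) : Prop := ∀ e ∈ M, v ∉ e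

/-- A list of edges alternately in and out of `M`. -/
def AltList (M : Finset (Sym2 V)) (l : List (Sym2 V)) : Prop :=
  l.Chain' fun e f => (e ∈ M ↔ f ∉ M)

variable {G : SimpleGraph V}

/-- An M-alternating walk. -/
def IsAltWalk (M : Finset (Sym2 V)) {a b : V} (p : G.Walk a b) : Prop := AltList M p.edges

/-- A valid walk: it starts (resp. ends) with an M-exposed vertex or an edge of `M`. -/
def IsValidWalk (M : Finset (Sym2 V)) {a b : V} (p : G.Walk a b) : Prop :=
  (MExposed M a ∨ ∃ e ∈ M, p.edges.head? = some e) ∧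
  (MExposed M b ∨ ∃ e ∈ M, p.edges.getLast? = some e)

/-- w(P ∩ M), with multiplicity. -/
noncomputable def wIn (w : Sym2 V → ℝ) (M : Finset (Sym2 V)) (l : List (Sym2 V)) : ℝ :=
  (l.map fun e => if e ∈ M then w e else 0).sum

/-- w(P ∖ M), with multiplicity. -/
noncomputable def wOut (w : Sym2 V → ℝ) (M : Finset (Sym2 V)) (l : List (Sym2 V)) : ℝ :=
  (l.map fun e => if e ∈ M then 0 else w e).sum

/-- An M-augmenting walk. -/
def IsAugWalk (w : Sym2 V → ℝ) (M : Finset (Sym2 V)) {a b : V} (p : G.Walk a b) : Prop :=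
  IsAltWalk M p ∧ IsValidWalk M p ∧ wIn w M p.edges < wOut w M p.edges

/-- An M-augmenting path. -/
def IsAugPath (w : Sym2 V → ℝ) (M : Finset (Sym2 V)) {a b : V} (p : G.Walk a b) : Prop :=
  p.IsPath ∧ IsAugWalk w M p

/-- An M-alternating cycle (an even cycle alternately in and out of `M`). -/
def IsAltCycle (M : Finset (Sym2 V)) {a : V} (c : G.Walk a a) : Prop :=
  c.IsCycle ∧ Even c.length ∧ AltList M c.edges ∧
  ∀ e f : Sym2 V, c.edges.head? = some e → c.edges.getLast? = some f → (e ∈ M ↔ f ∉ M)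

/-- An M-augmenting cycle. -/
def IsAugCycle (w : Sym2 V → ℝ) (M : Finset (Sym2 V)) {a : V} (c : G.Walk a a) : Prop :=
  IsAltCycle M c ∧ wIn w M c.edges < wOut w M c.edges

/-- An M-blossom with base `a` (traversed starting and ending at its base). -/
def IsBlossom (M : Finset (Sym2 V)) {a : V} (c : G.Walk a a) : Prop :=
  c.IsCycle ∧ Odd c.length ∧ AltList M c.edges ∧
  ∀ e : Sym2 V, c.edges.head? = some e → e ∉ M

/-- An M-flower: an M-blossom `c` with base `a` together with a valid M-alternating
path `p` from the base `a` to the root `r`, starting with an edge of `M`. -/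
def IsFlower (M : Finset (Sym2 V)) {a r : V} (c : G.Walk a a) (p : G.Walk a r) : Prop :=
  IsBlossom M c ∧ p.IsPath ∧ AltList M p.edges ∧
  (∃ e ∈ M, p.edges.head? = some e) ∧
  (MExposed M r ∨ ∃ e ∈ M, p.edges.getLast? = some e)

/-- An M-augmenting flower (with root `r`). -/
def IsAugFlower (w : Sym2 V → ℝ) (M : Finset (Sym2 V)) {a r : V}
    (c : G.Walk a a) (p : G.Walk a r) : Prop :=
  IsFlower M c p ∧
  wIn w M c.edges + 2 * wIn w M p.edges < wOut w M c.edges + 2 * wOut w M p.edges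

/-- An M-bi-cycle: two M-blossoms `c`, `d` with bases `a`, `b` joined by an odd
M-alternating path `p` starting and ending with edges of `M`. -/
def IsBicycle (M : Finset (Sym2 V)) {a b : V}
    (c : G.Walk a a) (p : G.Walk a b) (d : G.Walk b b) : Prop :=
  IsBlossom M c ∧ IsBlossom M d ∧ p.IsPath ∧ Odd p.length ∧ AltList M p.edges ∧
  (∃ e ∈ M, p.edges.head? = some e) ∧ (∃ e ∈ M, p.edges.getLast? = some e)

/-- An M-augmenting bi-cycle. -/
def IsAugBicycle (w : Sym2 V → ℝ) (M : Finset (Sym2 V)) {a b : V}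
    (c : G.Walk a a) (p : G.Walk a b) (d : G.Walk b b) : Prop :=
  IsBicycle M c p d ∧
  wIn w M c.edges + 2 * wIn w M p.edges + wIn w M d.edges <
    wOut w M c.edges + 2 * wOut w M p.edges + wOut w M d.edges

/-- All edges of the walk are tight with respect to the fractional vertex cover `y`. -/
def IsTightWalk (w : Sym2 V → ℝ) (y : V → ℝ) {a b : V} (p : G.Walk a b) : Prop :=
  ∀ d ∈ p.darts, y d.toProd.1 + y d.toProd.2 = w s(d.toProd.1, d.toProd.2)

/-- `x'` is the result of alternate rounding on the odd cycle with edge set `C`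
at the vertex `u`: on `C` it is 0/1-valued, both edges of `C` at `u` get value 0,
and its 1-valued edges inside `C` perfectly match the remaining vertices of `C`. -/
def AltRoundedOn (x' : Sym2 V → ℝ) (C : Finset (Sym2 V)) (u : V) : Prop :=
  (∀ e ∈ C, x' e = 0 ∨ x' e = 1) ∧ (∀ e ∈ C, u ∈ e → x' e = 0) ∧
  ∀ z ∈ edgeVerts C, z ≠ u → ∃! e : Sym2 V, e ∈ C ∧ x' e = 1 ∧ z ∈ e


/-- The sum of the values of `x` on the edges at `v`. -/
def fracDegree (x : Sym2 V → ℝ) (v : V) : ℝ := ∑ e with v ∈ e, x e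

/-- The sum of the values of `y` on the ends of `e`. -/
def endSum (y : V → ℝ) (e : Sym2 V) : ℝ := ∑ v with v ∈ e, y v

lemma sum_mk_eq_fracDegree (x : Sym2 V → ℝ) (v : V) : ∑ u, x s(v, u) = fracDegree x v := by
  refine Finset.sum_bij (fun u _ => s(v, u)) (by simp) ?_ ?_ (by simp)
  · intro a _ b _ h
    exact Sym2.congr_right.mp h
  · intro e he
    obtain ⟨u, rfl⟩ := (Finset.mem_filter.mp he).2
    exact ⟨u, Finset.mem_univ _, rfl⟩

lemma endSum_mk (y : V → ℝ) {a b : V} (h : a ≠ b) : endSum y s(a, b) = y a + y b := by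
  have : (Finset.univ.filter fun v => v ∈ s(a, b)) = {a, b} := by
    ext v
    simp
  rw [endSum, this, Finset.sum_pair h]

lemma sum_mul_fracDegree (x : Sym2 V → ℝ) (y : V → ℝ) :
    ∑ v, y v * fracDegree x v = ∑ e, x e * endSum y e := by
  simp only [fracDegree, endSum, Finset.mul_sum, Finset.sum_filter, mul_ite, mul_zero]
  rw [Finset.sum_comm]
  simp only [mul_comm]

namespace IsFracCover

variable {G : SimpleGraph V} {w x : Sym2 V → ℝ} {y : V → ℝ}

lemma le_endSum (hy : IsFracCover G w y) {e : Sym2 V} (he : e ∈ G.edgeSet) :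
    w e ≤ endSum y e := by
  induction e with
  | _ a b =>
    rw [endSum_mk y (G.ne_of_adj he)]
    exact hy.2 a b he

lemma coverValue_sub_fracWeight (w x : Sym2 V → ℝ) (y : V → ℝ) :
    coverValue y - fracWeight w x =
      ∑ e, x e * (endSum y e - w e) + ∑ v, y v * (1 - fracDegree x v) := by
  simp only [mul_sub, Finset.sum_sub_distrib, sum_mul_fracDegree, mul_one, coverValue, fracWeight]
  simp only [mul_comm (w _)]
  ring

lemma edge_slack_nonneg (hy : IsFracCover G w y) (hx : IsFracMatching G x) (e : Sym2 V) :
    0 ≤ x e * (endSum y e - w e) := by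
  by_cases he : e ∈ G.edgeSet
  · exact mul_nonneg (hx.1 e) (sub_nonneg.mpr (hy.le_endSum he))
  · simp [hx.2.1 e he]

lemma vertex_slack_nonneg (hy : IsFracCover G w y) (hx : IsFracMatching G x) (v : V) :
    0 ≤ y v * (1 - fracDegree x v) :=
  mul_nonneg (hy.1 v) (sub_nonneg.mpr (sum_mk_eq_fracDegree x v ▸ hx.2.2 v))

/-- Weak duality. -/
lemma fracWeight_le_coverValue (hy : IsFracCover G w y) (hx : IsFracMatching G x) :
    fracWeight w x ≤ coverValue y := by
  rw [← sub_nonneg, coverValue_sub_fracWeight]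
  exact add_nonneg (Finset.sum_nonneg fun e _ => hy.edge_slack_nonneg hx e)
    (Finset.sum_nonneg fun v _ => hy.vertex_slack_nonneg hx v)

/-- Complementary slackness. -/
lemma complementary_slackness (hy : IsFracCover G w y) (hx : IsFracMatching G x)
    (h : coverValue y ≤ fracWeight w x) :
    (∀ e, x e * (endSum y e - w e) = 0) ∧ ∀ v, y v * (1 - fracDegree x v) = 0 := by
  have hE := Finset.sum_nonneg fun e (_ : e ∈ Finset.univ) => hy.edge_slack_nonneg hx e
  have hV := Finset.sum_nonneg fun v (_ : v ∈ Finset.univ) => hy.vertex_slack_nonneg hx v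
  have hsum := coverValue_sub_fracWeight w x y
  constructor
  · intro e
    exact (Finset.sum_eq_zero_iff_of_nonneg fun e _ => hy.edge_slack_nonneg hx e).mp
      (by linarith) e (Finset.mem_univ e)
  · intro v
    exact (Finset.sum_eq_zero_iff_of_nonneg fun v _ => hy.vertex_slack_nonneg hx v).mp
      (by linarith) v (Finset.mem_univ v)

end IsFracCover

/-- The pairs of a vector dominating the degrees of some nonnegative edge vector supported on `G`,
and a number dominated by the weight of that edge vector. -/
def degreeWeightCone (G : SimpleGraph V) (w : Sym2 V → ℝ) : Set ((V → ℝ) × ℝ) :=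
  {p | ∃ x : Sym2 V → ℝ, (∀ e, 0 ≤ x e) ∧ (∀ e, e ∉ G.edgeSet → x e = 0) ∧
    (∀ v, fracDegree x v ≤ p.1 v) ∧ p.2 ≤ fracWeight w x}

lemma fracDegree_add_smul (a b : ℝ) (x z : Sym2 V → ℝ) (v : V) :
    fracDegree (a • x + b • z) v = a * fracDegree x v + b * fracDegree z v := by
  simp [fracDegree, Finset.sum_add_distrib, Finset.mul_sum]

omit [DecidableEq V] in
lemma fracWeight_add_smul (w : Sym2 V → ℝ) (a b : ℝ) (x z : Sym2 V → ℝ) :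
    fracWeight w (a • x + b • z) = a * fracWeight w x + b * fracWeight w z := by
  simp [fracWeight, Finset.mul_sum, mul_add, Finset.sum_add_distrib, mul_left_comm]

lemma degreeWeightCone_add_smul {G : SimpleGraph V} {w : Sym2 V → ℝ} {p q : (V → ℝ) × ℝ}
    (hp : p ∈ degreeWeightCone G w) (hq : q ∈ degreeWeightCone G w) {a b : ℝ}
    (ha : 0 ≤ a) (hb : 0 ≤ b) : a • p + b • q ∈ degreeWeightCone G w := by
  obtain ⟨x, hx, hx', hxd, hxw⟩ := hp
  obtain ⟨z, hz, hz', hzd, hzw⟩ := hq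
  refine ⟨a • x + b • z, fun e => ?_, fun e he => ?_, fun v => ?_, ?_⟩
  · have := mul_nonneg ha (hx e)
    have := mul_nonneg hb (hz e)
    simp only [Pi.add_apply, Pi.smul_apply, smul_eq_mul]
    positivity
  · simp [hx' e he, hz' e he]
  · rw [fracDegree_add_smul]
    simpa using add_le_add (mul_le_mul_of_nonneg_left (hxd v) ha)
      (mul_le_mul_of_nonneg_left (hzd v) hb)
  · rw [fracWeight_add_smul]
    simpa using add_le_add (mul_le_mul_of_nonneg_left hxw ha) (mul_le_mul_of_nonneg_left hzw hb)

/-- Strong duality. -/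
lemma IsMaxFracMatching.exists_fracCover {G : SimpleGraph V} {w x : Sym2 V → ℝ}
    (hx : IsMaxFracMatching G w x) :
    ∃ y, IsFracCover G w y ∧ coverValue y ≤ fracWeight w x := by
  have hM0 : 0 ≤ fracWeight w x := by
    simpa [fracWeight] using hx.2 0 ⟨by simp, by simp, by simp⟩
  set M := fracWeight w x
  let U : Set ((V → ℝ) × ℝ) := (Set.univ.pi fun _ => Set.Iio 1) ×ˢ Set.Ioi M
  have hUo : IsOpen U := (isOpen_set_pi Set.finite_univ fun _ _ => isOpen_Iio).prod isOpen_Ioi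
  have hUc : Convex ℝ U := (convex_pi fun _ _ => convex_Iio 1).prod (convex_Ioi M)
  have hKc : Convex ℝ (degreeWeightCone G w) := fun _ hp _ hq _ _ ha hb _ =>
    degreeWeightCone_add_smul hp hq ha hb
  have hdisj : Disjoint U (degreeWeightCone G w) := by
    rw [Set.disjoint_left]
    rintro ⟨b, c⟩ ⟨hb, hc⟩ ⟨z, hz, hz', hzd, hzw⟩
    refine absurd (hx.2 z ⟨hz, hz', fun v => ?_⟩) (not_le.mpr (lt_of_lt_of_le hc hzw))
    rw [sum_mk_eq_fracDegree]
    exact (hzd v).trans (le_of_lt (hb v trivial))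
  obtain ⟨f, α, hfU, hfK⟩ := geometric_hahn_banach_open hUc hUo hKc hdisj
  have h0 : (0 : (V → ℝ) × ℝ) ∈ degreeWeightCone G w :=
    ⟨0, by simp, by simp, by simp [fracDegree], by simp [fracWeight]⟩
  have hα : α ≤ 0 := by simpa using hfK 0 h0
  have hK : ∀ k ∈ degreeWeightCone G w, 0 ≤ f k := by
    intro k hk
    by_contra! hneg
    have hmem := degreeWeightCone_add_smul hk h0 (a := (α - 1) / f k)
      (div_nonneg_of_nonpos (by linarith) hneg.le) le_rfl
    have := hfK _ hmem
    simp only [smul_zero, add_zero, map_smul, smul_eq_mul, div_mul_cancel₀ _ hneg.ne] at this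
    linarith
  let p : V → ℝ := fun v => f (Pi.single v 1, 0)
  let q : ℝ := f (0, 1)
  have hf : ∀ b c, f (b, c) = ∑ v, b v * p v + c * q := by
    intro b c
    have hbc : (b, c) = ∑ v, b v • ((Pi.single v 1, 0) : (V → ℝ) × ℝ) + c • (0, 1) := by
      refine Prod.ext ?_ ?_
      · ext u
        simp [Prod.fst_sum, Finset.sum_apply, Pi.single_apply]
      · simp [Prod.snd_sum]
    rw [hbc]
    simp only [map_add, map_sum, map_smul, smul_eq_mul, p, q]
  have hp : ∀ v, 0 ≤ p v := by
    intro v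
    refine hK _ ⟨0, by simp, by simp, fun u => ?_, by simp [fracWeight]⟩
    by_cases h : u = v <;> simp [fracDegree, h]
  have hq : q < 0 := by
    have := hfU (0, M + 1) ⟨fun v _ => by simp, by simp⟩
    rw [hf] at this
    simp only [Pi.zero_apply, zero_mul, Finset.sum_const_zero, zero_add] at this
    by_contra! h
    nlinarith
  have hedge : ∀ a b, G.Adj a b → 0 ≤ p a + p b + w s(a, b) * q := by
    intro a b hab
    have := hK (Pi.single a 1 + Pi.single b 1, w s(a, b))
      ⟨Pi.single s(a, b) 1, fun e => ?_, fun e he => ?_, fun v => ?_, ?_⟩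
    · rw [hf] at this
      simpa [Pi.single_apply, add_mul, Finset.sum_add_distrib] using this
    · by_cases h : e = s(a, b) <;> simp [h]
    · rw [Pi.single_apply, if_neg]
      rintro rfl
      exact he hab
    · have hne := G.ne_of_adj hab
      by_cases h1 : v = a
      · subst h1
        simp [fracDegree, Pi.single_apply, hne]
      · by_cases h2 : v = b
        · subst h2
          simp [fracDegree, Pi.single_apply, h1]
        · simp [fracDegree, Pi.single_apply, h1, h2]
    · simp [fracWeight, Pi.single_apply]
  have hval : ∑ v, p v + M * q ≤ 0 := by
    by_contra! hpos
    have hT : 0 < ∑ v, p v - q := by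
      have := Finset.sum_nonneg fun v (_ : v ∈ Finset.univ) => hp v
      linarith
    set ε := (∑ v, p v + M * q) / (∑ v, p v - q)
    have hε0 : 0 < ε := div_pos hpos hT
    have := hfU (fun _ => 1 - ε, M + ε) ⟨fun v _ => by simpa using hε0, by simpa using hε0⟩
    rw [hf, ← Finset.mul_sum] at this
    have hmul : ε * (∑ v, p v - q) = ∑ v, p v + M * q := div_mul_cancel₀ _ hT.ne'
    nlinarith
  refine ⟨fun v => p v / -q, ⟨fun v => div_nonneg (hp v) (by linarith), fun a b hab => ?_⟩, ?_⟩
  · rw [← add_div, le_div_iff₀ (by linarith)]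
    linarith [hedge a b hab]
  · rw [coverValue, ← Finset.sum_div, div_le_iff₀ (by linarith)]
    linarith

omit [Fintype V] in
lemma IsOddCycleEdgeSet.subset_edgeSet {G : SimpleGraph V} {C : Finset (Sym2 V)}
    (hC : IsOddCycleEdgeSet G C) {e : Sym2 V} (he : e ∈ C) : e ∈ G.edgeSet := by
  obtain ⟨v, c, -, -, rfl⟩ := hC
  exact c.edges_subset_edgeSet (List.mem_toFinset.mp he)

omit [Fintype V] in
lemma IsOddCycleEdgeSet.exists_two_edges {G : SimpleGraph V} {C : Finset (Sym2 V)}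
    (hC : IsOddCycleEdgeSet G C) {v : V} (hv : v ∈ edgeVerts C) :
    ∃ e ∈ C, ∃ f ∈ C, e ≠ f ∧ v ∈ e ∧ v ∈ f := by
  obtain ⟨u, c, hc, -, rfl⟩ := hC
  obtain ⟨e, he, hve⟩ := hv
  have hvs : v ∈ c.support :=
    SimpleGraph.Walk.mem_support_of_mem_edges (List.mem_toFinset.mp he) hve
  have hr := hc.rotate hvs
  have hmem : ∀ e, e ∈ (c.rotate v hvs).edges → e ∈ c.edges.toFinset := fun e h =>
    List.mem_toFinset.mpr ((c.rotate_edges v hvs).mem_iff.mp h)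
  refine ⟨s(v, (c.rotate v hvs).snd), hmem _ ?_, s((c.rotate v hvs).penultimate, v), hmem _ ?_,
    ?_, by simp, by simp⟩
  · exact SimpleGraph.Walk.mk_start_snd_mem_edges hr.not_nil
  · exact SimpleGraph.Walk.mk_penultimate_end_mem_edges hr.not_nil
  · rw [Sym2.eq_swap (a := (c.rotate v hvs).penultimate)]
    exact fun h => hr.snd_ne_penultimate (Sym2.congr_right.mp h)

omit [Fintype V] in
lemma IsOddCycleEdgeSet.of_subset {G H : SimpleGraph V} {C : Finset (Sym2 V)}
    (hC : IsOddCycleEdgeSet G C) (h : ∀ e ∈ C, e ∈ H.edgeSet) : IsOddCycleEdgeSet H C := by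
  obtain ⟨v, c, hc, hodd, rfl⟩ := hC
  have h' : ∀ e ∈ c.edges, e ∈ H.edgeSet := fun e he => h e (List.mem_toFinset.mpr he)
  exact ⟨v, c.transfer H h', hc.transfer h', by simpa using hodd, by simp⟩

omit [Fintype V] [DecidableEq V] in
lemma mem_edgeSet_deleteVerts_singleton {G : SimpleGraph V} {s : V} {e : Sym2 V} :
    e ∈ (deleteVerts G {s}).edgeSet ↔ e ∈ G.edgeSet ∧ s ∉ e := by
  induction e with
  | _ a b => simp [deleteVerts, eq_comm]

/-- A vertex of a cycle of half-valued edges is saturated by that cycle. -/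
lemma IsCycleFamily.eq_zero_of_notMem {G : SimpleGraph V} {x : Sym2 V → ℝ}
    {F : Finset (Finset (Sym2 V))} (hF : IsCycleFamily G x F) (hx : IsFracMatching G x)
    {C : Finset (Sym2 V)} (hC : C ∈ F) {v : V} (hv : v ∈ edgeVerts C) {g : Sym2 V}
    (hvg : v ∈ g) (hg : g ∉ C) : x g = 0 := by
  obtain ⟨e, he, f, hf, hef, hve, hvf⟩ := (hF.1 C hC).exists_two_edges hv
  have hsub : ({e, f, g} : Finset (Sym2 V)) ⊆ Finset.univ.filter fun e => v ∈ e := by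
    intro d hd
    simp only [Finset.mem_insert, Finset.mem_singleton] at hd
    rcases hd with rfl | rfl | rfl <;> simpa
  have hle := Finset.sum_le_sum_of_subset_of_nonneg hsub (f := x) fun d _ _ => hx.1 d
  have hdeg : fracDegree x v ≤ 1 := sum_mk_eq_fracDegree x v ▸ hx.2.2 v
  have heg : e ≠ g := fun h => hg (h ▸ he)
  have hfg : f ≠ g := fun h => hg (h ▸ hf)
  rw [Finset.sum_insert (by simp [hef, heg]), Finset.sum_pair hfg,
    (hF.2.2 e).mpr ⟨C, hC, he⟩, (hF.2.2 f).mpr ⟨C, hC, hf⟩] at hle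
  have := hx.1 g
  unfold fracDegree at hdeg
  linarith

/-- alternate rounding `x` on a cycle `C ∈ 𝒞(x)` at `s` and restricting
to `G∖s` gives a basic maximum-weight fractional matching of `G∖s`, and the
restriction of `y` (setting its value at `s` to 0) is a minimum fractional
w-vertex cover of `G∖s`. -/
theorem altRound_deleteVert
    {V : Type*} [Fintype V] [DecidableEq V]
    (G : SimpleGraph V) (w : Sym2 V → ℝ) (hw : ∀ e, 0 ≤ w e)
    (x : Sym2 V → ℝ) (F : Finset (Finset (Sym2 V)))
    (hx : IsMaxFracMatching G w x) (hhalf : IsHalfIntegral x)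
    (hF : IsCycleFamily G x F)
    (y : V → ℝ) (hy : IsMinFracCover G w y)
    (C : Finset (Sym2 V)) (hC : C ∈ F) (s : V) (hs : s ∈ edgeVerts C)
    (x' : Sym2 V → ℝ) (hround : AltRoundedOn x' C s)
    (hrest : ∀ e : Sym2 V, e ∉ C → x' e = x e)
    (x'' : Sym2 V → ℝ)
    (hres1 : ∀ e : Sym2 V, s ∈ e → x'' e = 0)
    (hres2 : ∀ e : Sym2 V, s ∉ e → x'' e = x' e) :
    IsMaxFracMatching (deleteVerts G {s}) w x'' ∧
    IsBasic (deleteVerts G {s}) x'' ∧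
    IsMinFracCover (deleteVerts G {s}) w (Function.update y s 0) := by
  have hxm := hx.1
  have hzero : ∀ v ∈ edgeVerts C, ∀ e, v ∈ e → e ∉ C → x e = 0 := fun v hv e hve he =>
    hF.eq_zero_of_notMem hxm hC hv hve he
  have hoff : ∀ e, e ∉ C → x'' e = x e := by
    intro e he
    by_cases hse : s ∈ e
    · rw [hres1 e hse, hzero s hs e hse he]
    · rw [hres2 e hse, hrest e he]
  have hon : ∀ e ∈ C, x'' e = x' e := by
    intro e he
    by_cases hse : s ∈ e
    · rw [hres1 e hse, hround.2.1 e he hse]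
    · exact hres2 e hse
  have hhalf_on : ∀ e ∈ C, x e = 1 / 2 := fun e he => (hF.2.2 e).mpr ⟨C, hC, he⟩
  have hdeg_s : fracDegree x'' s = 0 :=
    Finset.sum_eq_zero fun e he => hres1 e (Finset.mem_filter.mp he).2
  have hdeg_on : ∀ v ∈ edgeVerts C, v ≠ s → fracDegree x'' v = 1 := by
    intro v hv hvs
    obtain ⟨e, ⟨he, hone, hve⟩, huniq⟩ := hround.2.2 v hv hvs
    rw [fracDegree, Finset.sum_eq_single e, hon e he, hone]
    · intro f hf hfe
      have hvf := (Finset.mem_filter.mp hf).2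
      by_cases hfC : f ∈ C
      · rw [hon f hfC]
        exact (hround.1 f hfC).resolve_right fun h => hfe (huniq f ⟨hfC, h, hvf⟩)
      · rw [hoff f hfC, hzero v hv f hvf hfC]
    · intro h
      simp [hve] at h
  have hdeg_off : ∀ v, v ∉ edgeVerts C → fracDegree x'' v = fracDegree x v := fun v hv =>
    Finset.sum_congr rfl fun e he =>
      hoff e fun heC => hv ⟨e, heC, (Finset.mem_filter.mp he).2⟩
  have hmatch : IsFracMatching (deleteVerts G {s}) x'' := by
    refine ⟨fun e => ?_, fun e he => ?_, fun v => ?_⟩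
    · by_cases heC : e ∈ C
      · rw [hon e heC]
        rcases hround.1 e heC with h | h <;> simp [h]
      · rw [hoff e heC]
        exact hxm.1 e
    · by_cases hse : s ∈ e
      · exact hres1 e hse
      · have heG : e ∉ G.edgeSet := fun h =>
          he (mem_edgeSet_deleteVerts_singleton.mpr ⟨h, hse⟩)
        rw [hoff e fun h => heG ((hF.1 C hC).subset_edgeSet h), hxm.2.1 e heG]
    · rw [sum_mk_eq_fracDegree]
      by_cases hv : v ∈ edgeVerts C
      · by_cases hvs : v = s
        · rw [hvs, hdeg_s]
          exact zero_le_one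
        · exact (hdeg_on v hv hvs).le
      · rw [hdeg_off v hv, ← sum_mk_eq_fracDegree]
        exact hxm.2.2 v
  have hcover : IsFracCover (deleteVerts G {s}) w (Function.update y s 0) := by
    refine ⟨fun v => ?_, fun a b hab => ?_⟩
    · by_cases hv : v = s
      · simp [hv]
      · simpa [hv] using hy.1.1 v
    · obtain ⟨hG, ha, hb⟩ := hab
      rw [Function.update_of_ne ha, Function.update_of_ne hb]
      exact hy.1.2 a b hG
  obtain ⟨z, hz, hzx⟩ := hx.exists_fracCover
  obtain ⟨htight, hsat⟩ := hy.1.complementary_slackness hxm ((hy.2 z hz).trans hzx)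
  have hweight : fracWeight w x'' = coverValue (Function.update y s 0) := by
    calc
      fracWeight w x'' = ∑ e, x'' e * endSum y e := by
        refine Finset.sum_congr rfl fun e _ => ?_
        by_cases heC : e ∈ C
        · have := htight e
          rw [hhalf_on e heC] at this
          have : endSum y e = w e := by linarith
          rw [this, mul_comm]
        · rw [hoff e heC]
          linarith [htight e]
      _ = ∑ v, y v * fracDegree x'' v := (sum_mul_fracDegree x'' y).symm
      _ = coverValue (Function.update y s 0) := by
        refine Finset.sum_congr rfl fun v _ => ?_
        by_cases hvs : v = s
        · simp [hvs, hdeg_s]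
        · rw [Function.update_of_ne hvs]
          by_cases hv : v ∈ edgeVerts C
          · rw [hdeg_on v hv hvs, mul_one]
          · rw [hdeg_off v hv]
            linarith [hsat v]
  have hD : ∀ D ∈ F, D ≠ C → ∀ e ∈ D, s ∉ e ∧ e ∉ C := by
    intro D hDF hDC e he
    have hdisj := Set.disjoint_left.mp (hF.2.1 D hDF C hC hDC)
    refine ⟨fun hse => hdisj ⟨e, he, hse⟩ hs, fun heC => ?_⟩
    exact hdisj ⟨e, he, e.out_fst_mem⟩ ⟨e, heC, e.out_fst_mem⟩
  refine ⟨⟨hmatch, fun z hz => hweight ▸ hcover.fracWeight_le_coverValue hz⟩,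
    ⟨hmatch, fun e => ?_, F.erase C, fun D hDF => ?_, fun D hDF E hEF => ?_, fun e => ?_⟩,
    ⟨hcover, fun z hz => hweight ▸ hz.fracWeight_le_coverValue hmatch⟩⟩
  · by_cases heC : e ∈ C
    · rw [hon e heC]
      exact (hround.1 e heC).imp_right Or.inr
    · rw [hoff e heC]
      exact hhalf e
  · obtain ⟨hDC, hDF⟩ := Finset.mem_erase.mp hDF
    exact (hF.1 D hDF).of_subset fun e he => mem_edgeSet_deleteVerts_singleton.mpr
      ⟨(hF.1 D hDF).subset_edgeSet he, (hD D hDF hDC e he).1⟩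
  · exact hF.2.1 D (Finset.mem_of_mem_erase hDF) E (Finset.mem_of_mem_erase hEF)
  · constructor
    · intro he
      have heC : e ∉ C := by
        intro heC
        rw [hon e heC] at he
        rcases hround.1 e heC with h | h <;> norm_num [h] at he
      rw [hoff e heC] at he
      obtain ⟨D, hDF, heD⟩ := (hF.2.2 e).mp he
      exact ⟨D, Finset.mem_erase.mpr ⟨fun h => heC (h ▸ heD), hDF⟩, heD⟩
    · rintro ⟨D, hDF, heD⟩
      obtain ⟨hDC, hDF⟩ := Finset.mem_erase.mp hDF
      rw [hoff e (hD D hDF hDC e heD).2]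
      exact (hF.2.2 e).mpr ⟨D, hDF, heD⟩

end Stabilizer
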